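/- arXiv:2511.18971 — 6 statements merged into one kernel-verified Lean document; each statement's English description precedes it below -/
import Mathlib

section
/- For every real γ with 0 < γ ≤ γ₀, where γ₀ = 2·exp(−C_E), one has γ/(√(γ² + 1) + 1) ≤ K₀(γ)/K₁(γ) ≤ γ·(11/16 − ln(γ/2) − C_E), where C_E is the Euler–Mascheroni constant. -/
open MeasureTheory Real

/-- Modified Bessel function of the second kind of integer order `j`, via the integral
representation `K_j(γ) = (2^j j! / (2j)!) · γ^{-j} · ∫_γ^∞ e^{-λ} (λ² - γ²)^{j - 1/2} dλ`. -/
noncomputable def besselK (j : ℕ) (γ : ℝ) : ℝ :=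
  ((2 : ℝ) ^ j * (Nat.factorial j) / (Nat.factorial (2 * j)) / γ ^ j) *
    ∫ l in Set.Ioi γ, Real.exp (-l) * (l ^ 2 - γ ^ 2) ^ ((j : ℝ) - 1 / 2)

/-- The ratio `h_i(γ) = K_i(γ)/K_{i+1}(γ)`. -/
noncomputable def hRatio (i : ℕ) (γ : ℝ) : ℝ := besselK i γ / besselK (i + 1) γ

open Set Filter Topology

/-- The moment `∫₀^∞ cosh(t)^n e^{-γ cosh t} dt`. -/
noncomputable def coshMoment (n : ℕ) (γ : ℝ) : ℝ :=
  ∫ t in Ioi (0 : ℝ), cosh t ^ n * exp (-γ * cosh t)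

lemma cosh_pow_mul_exp_le (n : ℕ) {γ t : ℝ} (hγ : 0 < γ) (ht : 0 ≤ t) :
    cosh t ^ n * exp (-γ * cosh t) ≤
      n.factorial * (2 / γ) ^ n * exp (-(γ / 2) * t) := by
  have hc : 0 < cosh t := cosh_pos t
  have htc : t ≤ cosh t := (self_le_sinh_iff.2 ht).trans (sinh_lt_cosh t).le
  have h := Real.pow_div_factorial_le_exp (γ / 2 * cosh t) (by positivity) n
  rw [div_le_iff₀ (by positivity)] at h
  have hpow : cosh t ^ n = (2 / γ) ^ n * (γ / 2 * cosh t) ^ n := by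
    rw [← mul_pow]; congr 1; field_simp
  calc cosh t ^ n * exp (-γ * cosh t)
      ≤ (2 / γ) ^ n * (exp (γ / 2 * cosh t) * n.factorial) * exp (-γ * cosh t) := by
        rw [hpow]; gcongr
    _ = n.factorial * (2 / γ) ^ n * exp (-(γ / 2) * cosh t) := by
        have : exp (-(γ / 2) * cosh t) = exp (γ / 2 * cosh t) * exp (-γ * cosh t) := by
          rw [← exp_add]; ring_nf
        rw [this]; ring
    _ ≤ _ := by
        gcongr ?_ * exp ?_
        nlinarith

lemma integrableOn_cosh_pow_mul_exp (n : ℕ) {γ : ℝ} (hγ : 0 < γ) :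
    IntegrableOn (fun t ↦ cosh t ^ n * exp (-γ * cosh t)) (Ioi 0) := by
  refine ((integrableOn_exp_mul_Ioi (a := -(γ / 2)) (by linarith) 0).const_mul
    (n.factorial * (2 / γ) ^ n)).mono' (by fun_prop) ?_
  filter_upwards [ae_restrict_mem measurableSet_Ioi] with t ht
  have := cosh_pos t
  rw [norm_of_nonneg (by positivity)]
  exact cosh_pow_mul_exp_le n hγ (le_of_lt ht)

lemma coshMoment_pos (n : ℕ) {γ : ℝ} (hγ : 0 < γ) : 0 < coshMoment n γ := by
  refine (setIntegral_pos_iff_support_of_nonneg_ae ?_ (integrableOn_cosh_pow_mul_exp n hγ)).2 ?_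
  · filter_upwards with t
    have := cosh_pos t
    simp only [Pi.zero_apply]
    positivity
  · have : (Function.support fun t ↦ cosh t ^ n * exp (-γ * cosh t)) = univ := by
      ext t
      have := cosh_pos t
      simp [this.ne']
    rw [this, univ_inter]
    simp

lemma hasDerivAt_coshMoment (n : ℕ) {γ : ℝ} (hγ : 0 < γ) :
    HasDerivAt (coshMoment n) (-coshMoment (n + 1) γ) γ := by
  have h := (hasDerivAt_integral_of_dominated_loc_of_deriv_le
    (μ := volume.restrict (Ioi (0 : ℝ)))
    (F := fun γ t ↦ cosh t ^ n * exp (-γ * cosh t))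
    (F' := fun γ t ↦ -(cosh t ^ (n + 1) * exp (-γ * cosh t)))
    (bound := fun t ↦ cosh t ^ (n + 1) * exp (-(γ / 2) * cosh t))
    (Ioi_mem_nhds (half_lt_self hγ)) (Eventually.of_forall fun _ ↦ by fun_prop)
    (integrableOn_cosh_pow_mul_exp n hγ) (by fun_prop) ?_
    (integrableOn_cosh_pow_mul_exp (n + 1) (half_pos hγ)) ?_).2
  · rwa [integral_neg] at h
  · filter_upwards with t x hx
    have := cosh_pos t
    rw [norm_neg, norm_of_nonneg (by positivity)]
    have hx' : γ / 2 < x := hx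
    gcongr
  · filter_upwards with t x _
    have h := (((hasDerivAt_id x).neg.mul_const (cosh t)).exp).const_mul (cosh t ^ n)
    convert! h using 1
    simp
    ring

lemma tendsto_mul_exp_neg_cosh {f : ℝ → ℝ} (hf : ∀ t, 0 ≤ t → |f t| ≤ cosh t) {γ : ℝ}
    (hγ : 0 < γ) : Tendsto (fun t ↦ f t * exp (-γ * cosh t)) atTop (𝓝 0) := by
  have hlim : Tendsto (fun t ↦ (Nat.factorial 1) * (2 / γ) ^ 1 * exp (-(γ / 2) * t))
      atTop (𝓝 0) := by
    simpa only [mul_zero] using! (tendsto_exp_atBot.comp (tendsto_id.const_mul_atTop_of_neg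
      (neg_neg_of_pos (half_pos hγ)))).const_mul ((Nat.factorial 1 : ℝ) * (2 / γ) ^ 1)
  refine squeeze_zero_norm' ?_ hlim
  filter_upwards [eventually_ge_atTop 0] with t ht
  refine le_trans ?_ (cosh_pow_mul_exp_le 1 hγ ht)
  rw [norm_mul, norm_eq_abs, norm_of_nonneg (exp_pos _).le, pow_one]
  gcongr
  exact hf t ht

lemma coshMoment_one_eq {γ : ℝ} (hγ : 0 < γ) :
    coshMoment 1 γ = γ * (coshMoment 2 γ - coshMoment 0 γ) := by
  have i0 := integrableOn_cosh_pow_mul_exp 0 hγ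
  have i1 := integrableOn_cosh_pow_mul_exp 1 hγ
  have i2 := integrableOn_cosh_pow_mul_exp 2 hγ
  have h := integral_Ioi_of_hasDerivAt_of_tendsto (a := 0) (m := 0)
    (f := fun t ↦ sinh t * exp (-γ * cosh t))
    (f' := fun t ↦ cosh t ^ 1 * exp (-γ * cosh t) - γ * (cosh t ^ 2 * exp (-γ * cosh t) -
      cosh t ^ 0 * exp (-γ * cosh t))) (by fun_prop) ?_
    (i1.sub ((Integrable.sub' i2 i0).const_mul γ)) (tendsto_mul_exp_neg_cosh ?_ hγ)
  · rw [integral_sub i1 ((Integrable.sub' i2 i0).const_mul γ), integral_const_mul, integral_sub i2 i0] at h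
    simp only [sinh_zero, zero_mul, sub_zero] at h
    unfold coshMoment
    linarith
  · intro t _
    have h := (hasDerivAt_sinh t).mul (((hasDerivAt_cosh t).const_mul (-γ)).exp)
    convert! h using 1
    linear_combination (-γ * exp (-γ * cosh t)) * cosh_sq t
  · intro t ht
    rw [abs_of_nonneg (sinh_nonneg_iff.2 ht)]
    exact (sinh_lt_cosh t).le

lemma integrableOn_exp_div_cosh_add_one {γ : ℝ} (hγ : 0 < γ) :
    IntegrableOn (fun t ↦ exp (-γ * cosh t) / (cosh t + 1)) (Ioi 0) := by
  have hpos : ∀ t, 0 < cosh t + 1 := fun t ↦ by linarith [cosh_pos t]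
  refine (integrableOn_cosh_pow_mul_exp 0 hγ).mono'
    (Continuous.aestronglyMeasurable (by fun_prop (disch := exact fun t ↦ (hpos t).ne'))) ?_
  filter_upwards with t
  have := hpos t
  rw [norm_of_nonneg (by positivity), pow_zero, one_mul]
  exact div_le_self (exp_pos _).le (by linarith [cosh_pos t])

lemma integral_exp_div_cosh_add_one {γ : ℝ} (hγ : 0 < γ) :
    ∫ t in Ioi (0 : ℝ), exp (-γ * cosh t) / (cosh t + 1) =
      γ * (coshMoment 1 γ - coshMoment 0 γ) := by
  have hpos : ∀ t, 0 < cosh t + 1 := fun t ↦ by linarith [cosh_pos t]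
  have i0 := integrableOn_cosh_pow_mul_exp 0 hγ
  have i1 := integrableOn_cosh_pow_mul_exp 1 hγ
  have iN := integrableOn_exp_div_cosh_add_one hγ
  have h := integral_Ioi_of_hasDerivAt_of_tendsto (a := 0) (m := 0)
    (f := fun t ↦ sinh t / (cosh t + 1) * exp (-γ * cosh t))
    (f' := fun t ↦ exp (-γ * cosh t) / (cosh t + 1) - γ * (cosh t ^ 1 * exp (-γ * cosh t) -
      cosh t ^ 0 * exp (-γ * cosh t)))
    (Continuous.continuousWithinAt (by fun_prop (disch := exact fun t ↦ (hpos t).ne'))) ?_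
    (iN.sub ((Integrable.sub' i1 i0).const_mul γ)) (tendsto_mul_exp_neg_cosh ?_ hγ)
  · rw [integral_sub iN ((Integrable.sub' i1 i0).const_mul γ), integral_const_mul, integral_sub i1 i0] at h
    simp only [sinh_zero, zero_div, zero_mul, sub_zero] at h
    unfold coshMoment
    linarith
  · intro t _
    have hne := (hpos t).ne'
    have h := ((hasDerivAt_sinh t).div ((hasDerivAt_cosh t).add_const 1) hne).mul
      (((hasDerivAt_cosh t).const_mul (-γ)).exp)
    convert! h using 1
    simp only [Pi.div_apply]
    field_simp
    rw [show sinh t ^ 2 = cosh t ^ 2 - 1 by linarith [cosh_sq t]]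
    ring
  · intro t ht
    rw [abs_of_nonneg (div_nonneg (sinh_nonneg_iff.2 ht) (hpos t).le)]
    refine (div_le_self (sinh_nonneg_iff.2 ht) ?_).trans (sinh_lt_cosh t).le
    linarith [cosh_pos t]

lemma coshMoment_one_sq_le {γ : ℝ} (hγ : 0 < γ) :
    coshMoment 1 γ ^ 2 ≤ coshMoment 0 γ * coshMoment 2 γ := by
  have i0 := integrableOn_cosh_pow_mul_exp 0 hγ
  have i1 := integrableOn_cosh_pow_mul_exp 1 hγ
  have i2 := integrableOn_cosh_pow_mul_exp 2 hγ
  have hquad : ∀ x : ℝ, 0 ≤ coshMoment 0 γ * (x * x) + (-2 * coshMoment 1 γ) * x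
      + coshMoment 2 γ := fun x ↦ by
    have h : 0 ≤ ∫ t in Ioi (0 : ℝ), (x * x * (cosh t ^ 0 * exp (-γ * cosh t))
        + -2 * x * (cosh t ^ 1 * exp (-γ * cosh t)) + cosh t ^ 2 * exp (-γ * cosh t)) := by
      refine integral_nonneg fun t ↦ ?_
      have : 0 ≤ (cosh t - x) ^ 2 * exp (-γ * cosh t) := by positivity
      simp only [Pi.zero_apply]
      linarith
    rw [integral_add (Integrable.fun_add (i0.const_mul _) (i1.const_mul _)) i2,
      integral_add (i0.const_mul _) (i1.const_mul _), integral_const_mul,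
      integral_const_mul] at h
    unfold coshMoment
    linarith
  have := discrim_le_zero hquad
  rw [discrim] at this
  linarith

/-- The Cauchy-Schwarz bound `K₀(γ)² / K₁(γ)² ≤ γ / (γ + 1)`. -/
lemma coshMoment_zero_sq_le {γ : ℝ} (hγ : 0 < γ) :
    (γ + 1) * coshMoment 0 γ ^ 2 ≤ γ * coshMoment 1 γ ^ 2 := by
  have i0 := integrableOn_cosh_pow_mul_exp 0 hγ
  have i1 := integrableOn_cosh_pow_mul_exp 1 hγ
  have iN := integrableOn_exp_div_cosh_add_one hγ
  have hquad : ∀ x : ℝ, 0 ≤ (coshMoment 1 γ + coshMoment 0 γ) * (x * x)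
      + (-2 * coshMoment 0 γ) * x + γ * (coshMoment 1 γ - coshMoment 0 γ) := fun x ↦ by
    have h : 0 ≤ ∫ t in Ioi (0 : ℝ), (x * x * (cosh t ^ 1 * exp (-γ * cosh t))
        + (x * x - 2 * x) * (cosh t ^ 0 * exp (-γ * cosh t))
        + exp (-γ * cosh t) / (cosh t + 1)) := by
      refine integral_nonneg fun t ↦ ?_
      have hpos : 0 < cosh t + 1 := by linarith [cosh_pos t]
      have h : 0 ≤ (x * (cosh t + 1) - 1) ^ 2 * (exp (-γ * cosh t) / (cosh t + 1)) := by
        positivity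
      simp only [Pi.zero_apply]
      convert! h using 1
      field_simp
      ring
    rw [integral_add (Integrable.fun_add (i1.const_mul _) (i0.const_mul _)) iN,
      integral_add (i1.const_mul _) (i0.const_mul _), integral_const_mul,
      integral_const_mul, integral_exp_div_cosh_add_one hγ] at h
    unfold coshMoment at h ⊢
    linarith
  have := discrim_le_zero hquad
  rw [discrim] at this
  linarith

lemma image_mul_cosh_Ioi {γ : ℝ} (hγ : 0 < γ) :
    (fun t ↦ γ * cosh t) '' Ioi 0 = Ioi γ := by
  ext l
  simp only [mem_image, mem_Ioi]
  constructor
  · rintro ⟨t, ht, rfl⟩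
    exact lt_mul_of_one_lt_right hγ (one_lt_cosh.2 ht.ne')
  · intro hl
    have h : 1 < l / γ := (one_lt_div hγ).2 hl
    refine ⟨arcosh (l / γ), arcosh_pos h, ?_⟩
    rw [cosh_arcosh h.le]
    field_simp

lemma integral_Ioi_eq_integral_cosh (g : ℝ → ℝ) {γ : ℝ} (hγ : 0 < γ) :
    ∫ l in Ioi γ, g l = ∫ t in Ioi (0 : ℝ), γ * sinh t * g (γ * cosh t) := by
  rw [← image_mul_cosh_Ioi hγ, integral_image_eq_integral_abs_deriv_smul measurableSet_Ioi
    (fun t _ ↦ ((hasDerivAt_cosh t).const_mul γ).hasDerivWithinAt)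
    (fun s hs t ht h ↦ cosh_injOn (Ioi_subset_Ici_self hs) (Ioi_subset_Ici_self ht) (mul_left_cancel₀ hγ.ne' h))]
  refine setIntegral_congr_fun measurableSet_Ioi fun t ht ↦ ?_
  have := sinh_pos_iff.2 ht
  simp only [smul_eq_mul]
  rw [abs_of_nonneg (by positivity)]

lemma besselK_zero_eq {γ : ℝ} (hγ : 0 < γ) : besselK 0 γ = coshMoment 0 γ := by
  rw [besselK, integral_Ioi_eq_integral_cosh _ hγ, coshMoment]
  simp only [pow_zero, Nat.factorial, Nat.cast_one, mul_one, div_one, one_mul]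
  refine setIntegral_congr_fun measurableSet_Ioi fun t ht ↦ ?_
  have hs := sinh_pos_iff.2 ht
  have h : (γ * cosh t) ^ 2 - γ ^ 2 = (γ * sinh t) ^ 2 := by
    linear_combination γ ^ 2 * cosh_sq t
  simp only [h]
  rw [Nat.cast_zero, zero_sub, rpow_neg (by positivity), ← sqrt_eq_rpow,
    sqrt_sq (by positivity), neg_mul]
  field_simp

lemma besselK_one_eq {γ : ℝ} (hγ : 0 < γ) : besselK 1 γ = coshMoment 1 γ := by
  have i0 := integrableOn_cosh_pow_mul_exp 0 hγ
  have i2 := integrableOn_cosh_pow_mul_exp 2 hγ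
  rw [besselK, integral_Ioi_eq_integral_cosh _ hγ, coshMoment_one_eq hγ, coshMoment, coshMoment,
    ← integral_sub i2 i0, ← integral_const_mul, ← integral_const_mul]
  refine setIntegral_congr_fun measurableSet_Ioi fun t ht ↦ ?_
  have hs := sinh_pos_iff.2 ht
  have h : (γ * cosh t) ^ 2 - γ ^ 2 = (γ * sinh t) ^ 2 := by
    linear_combination γ ^ 2 * cosh_sq t
  simp only [h]
  rw [Nat.cast_one, show (1 : ℝ) - 1 / 2 = 1 / 2 by norm_num, ← sqrt_eq_rpow,
    sqrt_sq (by positivity)]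
  simp [Nat.factorial]
  field_simp
  linear_combination -cosh_sq t

lemma monotoneOn_coshMoment_ratio_add_log :
    MonotoneOn (fun γ ↦ coshMoment 0 γ / (γ * coshMoment 1 γ) + log γ) (Ioi 0) := by
  have hderiv : ∀ γ ∈ Ioi (0 : ℝ),
      HasDerivAt (fun γ ↦ coshMoment 0 γ / (γ * coshMoment 1 γ) + log γ)
        (coshMoment 0 γ ^ 2 / (γ * coshMoment 1 γ ^ 2)) γ := by
    intro γ hγ
    have hγ : 0 < γ := hγ
    have h1 := coshMoment_pos 1 hγ
    have hrec : γ * coshMoment 2 γ = coshMoment 1 γ + γ * coshMoment 0 γ := by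
      linarith [coshMoment_one_eq hγ]
    have h := ((hasDerivAt_coshMoment 0 hγ).div
      ((hasDerivAt_id γ).mul (hasDerivAt_coshMoment 1 hγ)) (by simp [hγ.ne', h1.ne'])).add
      (hasDerivAt_log hγ.ne')
    convert! h using 1
    simp only [Pi.mul_apply, id_eq, zero_add, one_mul, Nat.reduceAdd]
    field_simp
    linear_combination -coshMoment 0 γ * hrec
  refine monotoneOn_of_deriv_nonneg (convex_Ioi 0)
    (fun γ hγ ↦ (hderiv γ hγ).continuousAt.continuousWithinAt)
    (fun γ hγ ↦ (hderiv γ (interior_subset hγ)).differentiableAt.differentiableWithinAt)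
    fun γ hγ ↦ ?_
  have hγ : γ ∈ Ioi (0 : ℝ) := interior_subset hγ
  rw [(hderiv γ hγ).deriv]
  have : 0 < γ := hγ
  positivity

lemma eulerMascheroniConstant_lt_d64 : eulerMascheroniConstant < 0.64 := by
  have h := eulerMascheroniConstant_lt_eulerMascheroniSeq' 8
  have h8 : eulerMascheroniSeq' 8 = 761 / 280 - log 8 := by
    rw [eulerMascheroniSeq']
    norm_num
  rw [h8, show (8 : ℝ) = 2 ^ 3 by norm_num, log_pow] at h
  have := log_two_gt_d9
  norm_num at h ⊢
  linarith

lemma two_mul_exp_neg_eulerMascheroniConstant_gt :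
    1.04 < 2 * exp (-eulerMascheroniConstant) := by
  have h : exp (-0.64 : ℝ) < exp (-eulerMascheroniConstant) :=
    exp_lt_exp.2 (neg_lt_neg eulerMascheroniConstant_lt_d64)
  have h' : (0.52 : ℝ) ≤ exp (-0.64) := by
    refine le_trans ?_ (one_sub_div_pow_le_exp_neg (n := 40) (t := 0.64) (by norm_num))
    norm_num
  linarith

/-- For `0 < γ ≤ γ₀ = 2 e^{-C_E}`,
`γ/(√(γ²+1)+1) ≤ K₀(γ)/K₁(γ) ≤ γ(11/16 − ln(γ/2) − C_E)`. -/
theorem bessel_ratio_bounds_small (γ : ℝ) (h1 : 0 < γ)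
    (h2 : γ ≤ 2 * Real.exp (-Real.eulerMascheroniConstant)) :
    γ / (Real.sqrt (γ ^ 2 + 1) + 1) ≤ besselK 0 γ / besselK 1 γ ∧
    besselK 0 γ / besselK 1 γ ≤
      γ * (11 / 16 - Real.log (γ / 2) - Real.eulerMascheroniConstant) := by
  rw [besselK_zero_eq h1, besselK_one_eq h1]
  have p0 := coshMoment_pos 0 h1
  have p1 := coshMoment_pos 1 h1
  constructor
  · have hcs := coshMoment_one_sq_le h1
    have hrec := coshMoment_one_eq h1
    rw [div_le_div_iff₀ (by positivity) p1]
    set a := coshMoment 0 γ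
    set b := coshMoment 1 γ
    have hs : γ * b ≤ a * sqrt (γ ^ 2 + 1) + a := by
      have hquad : γ * b ^ 2 ≤ a * b + γ * a ^ 2 := by nlinarith
      have : γ * b - a ≤ sqrt (a ^ 2 * (γ ^ 2 + 1)) := by
        apply le_sqrt_of_sq_le
        nlinarith [mul_pos (mul_pos h1 p0) p1]
      rw [sqrt_mul (sq_nonneg a), sqrt_sq p0.le] at this
      linarith
    linarith
  · set g := 2 * exp (-eulerMascheroniConstant) with hg
    have hg0 : 0 < g := by positivity
    have hg1 : 1.04 < g := two_mul_exp_neg_eulerMascheroniConstant_gt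
    have hmono := monotoneOn_coshMoment_ratio_add_log (mem_Ioi.2 h1) (mem_Ioi.2 hg0) h2
    simp only at hmono
    have q0 := coshMoment_pos 0 hg0
    have q1 := coshMoment_pos 1 hg0
    have hend : coshMoment 0 g / (g * coshMoment 1 g) ≤ 11 / 16 := by
      rw [div_le_iff₀ (by positivity)]
      refine le_of_sq_le_sq ?_ (by positivity)
      have hcs := coshMoment_zero_sq_le hg0
      refine le_of_mul_le_mul_left (hcs.trans ?_) (by positivity : 0 < g + 1)
      have hnum : 256 ≤ 121 * (g * (g + 1)) := by nlinarith
      have := mul_le_mul_of_nonneg_left hnum (by positivity : 0 ≤ g * coshMoment 1 g ^ 2)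
      linarith
    have hlog : log g = log 2 - eulerMascheroniConstant := by
      rw [hg, log_mul (by norm_num) (exp_pos _).ne', log_exp]
      ring
    rw [log_div h1.ne' (by norm_num)]
    have key : coshMoment 0 γ / (γ * coshMoment 1 γ) ≤
        11 / 16 - (log γ - log 2) - eulerMascheroniConstant := by linarith
    calc coshMoment 0 γ / coshMoment 1 γ
        = γ * (coshMoment 0 γ / (γ * coshMoment 1 γ)) := by field_simp
      _ ≤ _ := by gcongr
end

section
/- For every real γ > 0, one has (K₀(γ)/K₁(γ))² + (2/γ)·(K₀(γ)/K₁(γ)) − 1 > 0. -/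
open MeasureTheory Real

/-- The density `e^{-l} (l² - γ²)^{-1/2}` whose integral over `(γ, ∞)` is `K₀(γ)`. -/
noncomputable def besselWeight (γ l : ℝ) : ℝ := exp (-l) / √(l ^ 2 - γ ^ 2)

lemma sq_sub_sq_pos_of_mem_Ioi {γ l : ℝ} (hγ : 0 < γ) (hl : l ∈ Set.Ioi γ) :
    0 < l ^ 2 - γ ^ 2 := by
  have : γ < l := hl
  nlinarith

lemma besselWeight_pos {γ l : ℝ} (hγ : 0 < γ) (hl : l ∈ Set.Ioi γ) : 0 < besselWeight γ l := by
  have := sq_sub_sq_pos_of_mem_Ioi hγ hl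
  unfold besselWeight
  positivity

lemma measurable_besselWeight (γ : ℝ) : Measurable (besselWeight γ) := by
  unfold besselWeight
  fun_prop

lemma exp_mul_sqrt_eq_besselWeight {γ l : ℝ} (hγ : 0 < γ) (hl : l ∈ Set.Ioi γ) :
    exp (-l) * √(l ^ 2 - γ ^ 2) = (l ^ 2 - γ ^ 2) * besselWeight γ l := by
  have h := sq_sub_sq_pos_of_mem_Ioi hγ hl
  have h' := Real.sqrt_pos.2 h
  unfold besselWeight
  field_simp
  rw [Real.sq_sqrt h.le]

lemma integrableOn_sq_mul_besselWeight {γ : ℝ} (hγ : 0 < γ) :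
    IntegrableOn (fun l => l ^ 2 * besselWeight γ l) (Set.Ioi γ) := by
  have shifted : ∀ s : ℝ, 0 < s →
      IntegrableOn (fun l => exp (-(l - γ)) * (l - γ) ^ (s - 1)) (Set.Ioi γ) := by
    intro s hs
    have h := (MeasurePreserving.integrableOn_comp_preimage
      (measurePreserving_sub_right volume γ) (measurableEmbedding_subRight γ)).2
      (Real.GammaIntegral_convergent hs)
    simpa [Function.comp_def] using h
  have dominating := ((shifted (5 / 2) (by norm_num)).const_mul 2).add
    ((shifted (1 / 2) (by norm_num)).const_mul (2 * γ ^ 2))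
  refine Integrable.mono' (dominating.const_mul (1 / √(2 * γ)))
    (by have := measurable_besselWeight γ; fun_prop) ?_
  filter_upwards [ae_restrict_mem measurableSet_Ioi] with l hl
  have hu : 0 < l - γ := sub_pos.2 hl
  have hlow : √(2 * γ) * √(l - γ) ≤ √(l ^ 2 - γ ^ 2) := by
    rw [← Real.sqrt_mul (by positivity)]
    exact Real.sqrt_le_sqrt (by nlinarith)
  have hs := Real.sqrt_pos.2 hu
  have hpow : (l - γ) ^ ((5 : ℝ) / 2 - 1) = (l - γ) ^ 2 / √(l - γ) := by
    rw [Real.sqrt_eq_rpow, ← Real.rpow_natCast, ← Real.rpow_sub hu]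
    norm_num
  have hpow' : (l - γ) ^ ((1 : ℝ) / 2 - 1) = 1 / √(l - γ) := by
    rw [Real.sqrt_eq_rpow, one_div ((l - γ) ^ ((1 : ℝ) / 2)), ← Real.rpow_neg hu.le]
    norm_num
  have hw := besselWeight_pos hγ hl
  rw [Real.norm_of_nonneg (by positivity)]
  simp only [Pi.add_apply, hpow, hpow']
  calc l ^ 2 * besselWeight γ l
      ≤ (2 * (l - γ) ^ 2 + 2 * γ ^ 2) * (exp (-(l - γ)) / (√(2 * γ) * √(l - γ))) := by
        unfold besselWeight
        gcongr
        · nlinarith [sq_nonneg (l - 2 * γ)]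
        · linarith
    _ = _ := by field_simp

lemma integrableOn_mul_besselWeight_of_abs_le {γ c : ℝ} (hγ : 0 < γ) {p : ℝ → ℝ}
    (hp : Measurable p) (hle : ∀ l ∈ Set.Ioi γ, |p l| ≤ c * l ^ 2) :
    IntegrableOn (fun l => p l * besselWeight γ l) (Set.Ioi γ) := by
  refine Integrable.mono' ((integrableOn_sq_mul_besselWeight hγ).const_mul c)
    (by have := measurable_besselWeight γ; fun_prop) ?_
  filter_upwards [ae_restrict_mem measurableSet_Ioi] with l hl
  have hw := besselWeight_pos hγ hl
  rw [norm_mul, Real.norm_of_nonneg hw.le, Real.norm_eq_abs, ← mul_assoc]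
  exact mul_le_mul_of_nonneg_right (hle l hl) hw.le

lemma integrableOn_besselWeight {γ : ℝ} (hγ : 0 < γ) :
    IntegrableOn (besselWeight γ) (Set.Ioi γ) := by
  have := integrableOn_mul_besselWeight_of_abs_le (c := 1 / γ ^ 2) hγ
    (measurable_const (a := (1 : ℝ))) fun l hl => by
      have hl : γ < l := hl
      rw [abs_one, div_mul_eq_mul_div, one_mul, le_div_iff₀ (by positivity)]
      nlinarith
  simpa using this

lemma integrableOn_id_mul_besselWeight {γ : ℝ} (hγ : 0 < γ) :
    IntegrableOn (fun l => l * besselWeight γ l) (Set.Ioi γ) :=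
  integrableOn_mul_besselWeight_of_abs_le (c := 1 / γ) hγ measurable_id fun l hl => by
    have hl : γ < l := hl
    rw [abs_of_pos (hγ.trans hl), div_mul_eq_mul_div, one_mul, le_div_iff₀ hγ]
    nlinarith

lemma integrableOn_exp_mul_sqrt {γ : ℝ} (hγ : 0 < γ) :
    IntegrableOn (fun l => exp (-l) * √(l ^ 2 - γ ^ 2)) (Set.Ioi γ) := by
  refine (integrableOn_congr_fun (fun l hl => exp_mul_sqrt_eq_besselWeight hγ hl)
    measurableSet_Ioi).2 (integrableOn_mul_besselWeight_of_abs_le (c := 1) hγ (by fun_prop)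
      fun l hl => ?_)
  rw [abs_of_pos (sq_sub_sq_pos_of_mem_Ioi hγ hl)]
  nlinarith

lemma integral_besselWeight_pos {γ : ℝ} (hγ : 0 < γ) :
    0 < ∫ l in Set.Ioi γ, besselWeight γ l := by
  rw [setIntegral_pos_iff_support_of_nonneg_ae _ (integrableOn_besselWeight hγ)]
  · have hsub : Set.Ioi γ ⊆ Function.support (besselWeight γ) :=
      fun l hl => (besselWeight_pos hγ hl).ne'
    rw [Set.inter_eq_self_of_subset_right hsub]
    simp
  · filter_upwards [ae_restrict_mem measurableSet_Ioi] with l hl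
    exact (besselWeight_pos hγ hl).le

/-- Integration by parts, with `√(l² - γ²)` as an antiderivative of `l / √(l² - γ²)`. -/
lemma integral_exp_mul_sqrt_eq {γ : ℝ} (hγ : 0 < γ) :
    ∫ l in Set.Ioi γ, exp (-l) * √(l ^ 2 - γ ^ 2) = ∫ l in Set.Ioi γ, l * besselWeight γ l := by
  have hI := integrableOn_exp_mul_sqrt hγ
  have hL := integrableOn_id_mul_besselWeight hγ
  have hlim : Filter.Tendsto (fun l => exp (-l) * √(l ^ 2 - γ ^ 2)) Filter.atTop (nhds 0) := by
    refine squeeze_zero' (.of_forall fun l => by positivity) ?_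
      (tendsto_pow_mul_exp_neg_atTop_nhds_zero 1)
    filter_upwards [Filter.eventually_ge_atTop 0] with l hl
    rw [pow_one, mul_comm]
    gcongr
    exact Real.sqrt_le_iff.2 ⟨hl, by nlinarith⟩
  have key := integral_Ioi_of_hasDerivAt_of_tendsto
    (f := fun l => exp (-l) * √(l ^ 2 - γ ^ 2)) (a := γ) (m := 0)
    (f' := fun l => l * besselWeight γ l - exp (-l) * √(l ^ 2 - γ ^ 2))
    (by fun_prop) (fun l hl => ?_) (hL.sub hI) hlim
  · rw [integral_sub hL hI] at key
    simp only [sub_self, Real.sqrt_zero, mul_zero] at key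
    linarith
  · have h := sq_sub_sq_pos_of_mem_Ioi hγ hl
    have hs := Real.sqrt_pos.2 h
    have hexp : HasDerivAt (fun l : ℝ => exp (-l)) (exp (-l) * -1) l := (hasDerivAt_neg l).exp
    have hsqrt := (((hasDerivAt_pow 2 l).sub_const (γ ^ 2)).sqrt h.ne')
    refine (hexp.mul hsqrt).congr_deriv ?_
    unfold besselWeight
    field_simp
    push_cast
    ring

/-- Cauchy–Schwarz for the functions `1` and `l` with respect to the weight. -/
lemma sq_integral_exp_mul_sqrt_le {γ : ℝ} (hγ : 0 < γ) :
    (∫ l in Set.Ioi γ, exp (-l) * √(l ^ 2 - γ ^ 2)) ^ 2 ≤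
      (∫ l in Set.Ioi γ, besselWeight γ l) *
        ((∫ l in Set.Ioi γ, exp (-l) * √(l ^ 2 - γ ^ 2)) +
          γ ^ 2 * ∫ l in Set.Ioi γ, besselWeight γ l) := by
  have hparts := integral_exp_mul_sqrt_eq hγ
  have hA := integral_besselWeight_pos hγ
  have hI := integrableOn_exp_mul_sqrt hγ
  have hW := integrableOn_besselWeight hγ
  have hL := integrableOn_id_mul_besselWeight hγ
  set A := ∫ l in Set.Ioi γ, besselWeight γ l
  set J := ∫ l in Set.Ioi γ, exp (-l) * √(l ^ 2 - γ ^ 2)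
  have hexpand : ∫ l in Set.Ioi γ, (A * l - J) ^ 2 * besselWeight γ l =
      A ^ 2 * J + (A ^ 2 * γ ^ 2 + J ^ 2) * A - 2 * A * J * J := by
    rw [setIntegral_congr_fun (g := fun l => A ^ 2 * (exp (-l) * √(l ^ 2 - γ ^ 2)) +
      (A ^ 2 * γ ^ 2 + J ^ 2) * besselWeight γ l - 2 * A * J * (l * besselWeight γ l))
      measurableSet_Ioi fun l hl => by
        simp only [exp_mul_sqrt_eq_besselWeight hγ hl]
        ring]
    have hsum : IntegrableOn (fun l => A ^ 2 * (exp (-l) * √(l ^ 2 - γ ^ 2)) +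
        (A ^ 2 * γ ^ 2 + J ^ 2) * besselWeight γ l) (Set.Ioi γ) :=
      (hI.const_mul _).add (hW.const_mul _)
    rw [integral_sub hsum (hL.const_mul _), integral_add (hI.const_mul _) (hW.const_mul _), integral_const_mul, integral_const_mul,
      integral_const_mul, ← hparts]
  have hnonneg : 0 ≤ ∫ l in Set.Ioi γ, (A * l - J) ^ 2 * besselWeight γ l :=
    setIntegral_nonneg measurableSet_Ioi fun l hl =>
      mul_nonneg (sq_nonneg _) (besselWeight_pos hγ hl).le
  rw [hexpand] at hnonneg
  refine le_of_mul_le_mul_left ?_ hA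
  linarith

lemma integral_exp_mul_sqrt_pos {γ : ℝ} (hγ : 0 < γ) :
    0 < ∫ l in Set.Ioi γ, exp (-l) * √(l ^ 2 - γ ^ 2) := by
  rw [integral_exp_mul_sqrt_eq hγ]
  refine (mul_pos hγ (integral_besselWeight_pos hγ)).trans_le ?_
  rw [← integral_const_mul]
  exact setIntegral_mono_on ((integrableOn_besselWeight hγ).const_mul γ)
    (integrableOn_id_mul_besselWeight hγ) measurableSet_Ioi fun l hl =>
      mul_le_mul_of_nonneg_right (le_of_lt hl) (besselWeight_pos hγ hl).le

lemma besselK_zero_eq_s12 {γ : ℝ} (hγ : 0 < γ) :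
    besselK 0 γ = ∫ l in Set.Ioi γ, besselWeight γ l := by
  simp only [besselK, pow_zero, mul_zero, Nat.factorial_zero, Nat.cast_one, mul_one, div_one,
    one_mul, Nat.cast_zero]
  refine setIntegral_congr_fun measurableSet_Ioi fun l hl => ?_
  have h := sq_sub_sq_pos_of_mem_Ioi hγ hl
  simp only [besselWeight, zero_sub]
  rw [Real.rpow_neg h.le, Real.sqrt_eq_rpow, ← div_eq_mul_inv]

lemma besselK_one_eq_s12 (γ : ℝ) :
    besselK 1 γ = (∫ l in Set.Ioi γ, exp (-l) * √(l ^ 2 - γ ^ 2)) / γ := by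
  have h : ((1 : ℕ) : ℝ) - 1 / 2 = 1 / 2 := by norm_num
  simp only [besselK, h, Real.sqrt_eq_rpow]
  norm_num [Nat.factorial]
  ring

/-- For every `γ > 0`, `(K₀/K₁)² + (2/γ)(K₀/K₁) − 1 > 0`. -/
theorem bessel_ratio_quadratic_pos (γ : ℝ) (hγ : 0 < γ) :
    (besselK 0 γ / besselK 1 γ) ^ 2 + (2 / γ) * (besselK 0 γ / besselK 1 γ) - 1 > 0 := by
  rw [besselK_zero_eq_s12 hγ, besselK_one_eq_s12]
  have hA := integral_besselWeight_pos hγ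
  have hJ := integral_exp_mul_sqrt_pos hγ
  have hCS := sq_integral_exp_mul_sqrt_le hγ
  set A := ∫ l in Set.Ioi γ, besselWeight γ l
  set J := ∫ l in Set.Ioi γ, exp (-l) * √(l ^ 2 - γ ^ 2)
  have heq : (A / (J / γ)) ^ 2 + 2 / γ * (A / (J / γ)) - 1 =
      (A ^ 2 * γ ^ 2 + 2 * A * J - J ^ 2) / J ^ 2 := by
    field_simp
  rw [heq]
  have := mul_pos hA hJ
  exact div_pos (by nlinarith) (by positivity)
end

section
/- For every real γ > 2, one has 1 − 1/(2γ) + 3/(8γ²) − 3/(8γ³) + 63/(128γ⁴) − 31/(20γ⁵) ≤ K₀(γ)/K₁(γ) ≤ 1 − 1/(2γ) + 3/(8γ²) − 3/(8γ³) + 63/(128γ⁴) + 7/(8γ⁵). -/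
open MeasureTheory Real

/-- Taylor bound for `(1 + u) ^ (-1/2)`, `u ≥ 0`, from above (degree four). -/
lemma one_add_rpow_neg_half_le {u : ℝ} (hu : 0 ≤ u) :
    (1 + u) ^ (-1 / 2 : ℝ) ≤
      1 - 1 / 2 * u + 3 / 8 * u ^ 2 - 5 / 16 * u ^ 3 + 35 / 128 * u ^ 4 := by
  have hy : 0 < 1 + u := by linarith
  set v := (1 + u) ^ (-1 / 2 : ℝ) with hv
  have hv0 : 0 < v := rpow_pos_of_pos hy _
  have hv2 : v ^ 2 * (1 + u) = 1 := by
    rw [hv, ← rpow_natCast, ← rpow_mul hy.le]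
    norm_num [rpow_neg_one, hy.ne']
  set q := 1 - 1 / 2 * u + 3 / 8 * u ^ 2 - 5 / 16 * u ^ 3 + 35 / 128 * u ^ 4 with hq
  have hq0 : 0 ≤ q := by
    have : q = (1 - u / 4) ^ 2 + u ^ 2 * (1 / 16 + (1 / 2 - 5 / 16 * u) ^ 2 + 90 / 512 * u ^ 2) := by
      rw [hq]; ring
    rw [this]; positivity
  have hq2 : 1 ≤ q ^ 2 * (1 + u) := by
    have : q ^ 2 * (1 + u) = 1 + u ^ 5 * (63 / 128 - 105 / 512 * u + 135 / 1024 * u ^ 2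
        - 1575 / 16384 * u ^ 3 + 1225 / 16384 * u ^ 4) := by
      rw [hq]; ring
    rw [this]
    have : 0 ≤ 63 / 128 - 105 / 512 * u + 135 / 1024 * u ^ 2
        - 1575 / 16384 * u ^ 3 + 1225 / 16384 * u ^ 4 := by
      nlinarith [sq_nonneg (u - 1), sq_nonneg (u * (u - 1)), sq_nonneg u, sq_nonneg (u ^ 2)]
    nlinarith [mul_nonneg (pow_nonneg hu 5) this]
  have : v ^ 2 ≤ q ^ 2 := le_of_mul_le_mul_right (hv2.trans_le hq2) hy
  exact (pow_le_pow_iff_left₀ hv0.le hq0 two_ne_zero).1 this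

/-- Taylor bound for `(1 + u) ^ (-1/2)`, `u ≥ 0`, from below (degree five). -/
lemma le_one_add_rpow_neg_half {u : ℝ} (hu : 0 ≤ u) :
    1 - 1 / 2 * u + 3 / 8 * u ^ 2 - 5 / 16 * u ^ 3 + 35 / 128 * u ^ 4 - 63 / 256 * u ^ 5 ≤
      (1 + u) ^ (-1 / 2 : ℝ) := by
  have hy : 0 < 1 + u := by linarith
  set v := (1 + u) ^ (-1 / 2 : ℝ) with hv
  have hv0 : 0 < v := rpow_pos_of_pos hy _
  have hv2 : v ^ 2 * (1 + u) = 1 := by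
    rw [hv, ← rpow_natCast, ← rpow_mul hy.le]
    norm_num [rpow_neg_one, hy.ne']
  set q := 1 - 1 / 2 * u + 3 / 8 * u ^ 2 - 5 / 16 * u ^ 3 + 35 / 128 * u ^ 4 - 63 / 256 * u ^ 5
    with hq
  rcases le_total q 0 with hq0 | hq0
  · exact hq0.trans hv0.le
  have hu2 : u ≤ 3 / 2 := by
    by_contra! h
    obtain ⟨d, rfl⟩ : ∃ d, u = 3 / 2 + d := ⟨u - 3 / 2, by ring⟩
    have hd : 0 < d := by linarith
    have h3 : 0 < d ^ 3 := by positivity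
    have h4 : 0 < d ^ 4 := by positivity
    have h5 : 0 < d ^ 5 := by positivity
    have h2 : 0 < d ^ 2 := by positivity
    nlinarith
  have hq2 : q ^ 2 * (1 + u) ≤ 1 := by
    have : q ^ 2 * (1 + u) = 1 - u ^ 6 * (231 / 512 - 99 / 512 * u + 2079 / 16384 * u ^ 2
        - 385 / 4096 * u ^ 3 + 4851 / 65536 * u ^ 4 - 3969 / 65536 * u ^ 5) := by
      rw [hq]; ring
    rw [this]
    have : 0 ≤ 231 / 512 - 99 / 512 * u + 2079 / 16384 * u ^ 2
        - 385 / 4096 * u ^ 3 + 4851 / 65536 * u ^ 4 - 3969 / 65536 * u ^ 5 := by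
      have h3 : 0 ≤ u ^ 2 * (3 / 2 - u) := mul_nonneg (by positivity) (by linarith)
      have h5 : 0 ≤ u ^ 4 * (3 / 2 - u) := mul_nonneg (by positivity) (by linarith)
      have h4 : 0 ≤ u ^ 3 * (3 / 2 - u) := mul_nonneg (by positivity) (by linarith)
      nlinarith
    nlinarith [mul_nonneg (pow_nonneg hu 6) this]
  have : q ^ 2 ≤ v ^ 2 := le_of_mul_le_mul_right (hq2.trans_eq hv2.symm) hy
  exact (pow_le_pow_iff_left₀ hq0 hv0.le two_ne_zero).1 this

/-- Taylor bound for `(1 + u) ^ (1/2)`, `u ≥ 0`, from above (degree five). -/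
lemma one_add_rpow_half_le {u : ℝ} (hu : 0 ≤ u) :
    (1 + u) ^ (1 / 2 : ℝ) ≤
      1 + 1 / 2 * u - 1 / 8 * u ^ 2 + 1 / 16 * u ^ 3 - 5 / 128 * u ^ 4 + 7 / 256 * u ^ 5 := by
  rw [← sqrt_eq_rpow]
  refine sqrt_le_iff.2 ⟨?_, ?_⟩
  · have : 0 ≤ 1 / 4 - 1 / 8 * u + 1 / 16 * u ^ 2 - 5 / 128 * u ^ 3 + 7 / 256 * u ^ 4 := by
      nlinarith [sq_nonneg (u - 1), sq_nonneg (u * (u - 1)), sq_nonneg u, sq_nonneg (u ^ 2)]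
    nlinarith [mul_nonneg hu this]
  · have : 0 ≤ 21 / 512 - 3 / 256 * u + 81 / 16384 * u ^ 2 - 35 / 16384 * u ^ 3
        + 49 / 65536 * u ^ 4 := by
      nlinarith [sq_nonneg (u - 1), sq_nonneg (u * (u - 1)), sq_nonneg u, sq_nonneg (u ^ 2)]
    nlinarith [mul_nonneg (pow_nonneg hu 6) this]

/-- Taylor bound for `(1 + u) ^ (1/2)`, `u ≥ 0`, from below (degree four). -/
lemma le_one_add_rpow_half {u : ℝ} (hu : 0 ≤ u) :
    1 + 1 / 2 * u - 1 / 8 * u ^ 2 + 1 / 16 * u ^ 3 - 5 / 128 * u ^ 4 ≤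
      (1 + u) ^ (1 / 2 : ℝ) := by
  rw [← sqrt_eq_rpow]
  rcases le_total u 3 with h | h
  · refine le_sqrt_of_sq_le ?_
    have : 0 ≤ 7 / 128 - 7 / 512 * u + 5 / 1024 * u ^ 2 - 25 / 16384 * u ^ 3 := by
      nlinarith [mul_nonneg (sq_nonneg u) (sub_nonneg.2 h), mul_nonneg hu (sub_nonneg.2 h)]
    nlinarith [mul_nonneg (pow_nonneg hu 5) this]
  · refine le_trans ?_ (sqrt_nonneg _)
    obtain ⟨d, rfl⟩ : ∃ d, u = 3 + d := ⟨u - 3, by ring⟩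
    have hd : 0 ≤ d := by linarith
    nlinarith [pow_nonneg hd 2, pow_nonneg hd 3, pow_nonneg hd 4]

/-- The integral `∫₀^∞ e^{-t} (t (1 + t / (2γ)))^a dt`, to which `besselK` reduces. -/
noncomputable def besselKernelIntegral (a γ : ℝ) : ℝ :=
  ∫ t in Set.Ioi (0 : ℝ), exp (-t) * t ^ a * (1 + t / (2 * γ)) ^ a

lemma integral_Ioi_eq_besselKernelIntegral (a : ℝ) {γ : ℝ} (hγ : 0 < γ) :
    ∫ l in Set.Ioi γ, exp (-l) * (l ^ 2 - γ ^ 2) ^ a =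
      exp (-γ) * (2 * γ) ^ a * besselKernelIntegral a γ := by
  have hshift := (measurePreserving_add_right (volume : Measure ℝ) γ).setIntegral_preimage_emb
    (MeasurableEquiv.addRight γ).measurableEmbedding
    (fun l => exp (-l) * (l ^ 2 - γ ^ 2) ^ a) (Set.Ioi γ)
  have hpre : (fun x : ℝ => x + γ) ⁻¹' Set.Ioi γ = Set.Ioi 0 := by
    ext x; simp
  rw [hpre] at hshift
  rw [← hshift, besselKernelIntegral, ← integral_const_mul]
  refine setIntegral_congr_fun measurableSet_Ioi fun t ht => ?_
  have ht : 0 < t := ht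
  have hfac : (t + γ) ^ 2 - γ ^ 2 = 2 * γ * (t * (1 + t / (2 * γ))) := by
    field_simp; ring
  simp only [hfac]
  rw [mul_rpow (by positivity) (by positivity), mul_rpow ht.le (by positivity), neg_add, exp_add]
  ring

lemma besselK_ratio_eq {γ : ℝ} (hγ : 0 < γ) :
    besselK 0 γ / besselK 1 γ =
      besselKernelIntegral (-1 / 2) γ / (2 * besselKernelIntegral (1 / 2) γ) := by
  have h0 : ((0 : ℕ) : ℝ) - 1 / 2 = -1 / 2 := by norm_num
  have h1 : ((1 : ℕ) : ℝ) - 1 / 2 = 1 / 2 := by norm_num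
  have h2 : (2 * γ) ^ (1 / 2 : ℝ) = 2 * γ * (2 * γ) ^ (-1 / 2 : ℝ) := by
    rw [← rpow_one_add' (by positivity) (by norm_num)]; norm_num
  have hp : 0 < (2 * γ) ^ (-1 / 2 : ℝ) := rpow_pos_of_pos (by positivity) _
  have he := exp_pos (-γ)
  rw [besselK, besselK, h0, h1, integral_Ioi_eq_besselKernelIntegral _ hγ,
    integral_Ioi_eq_besselKernelIntegral _ hγ, h2]
  norm_num [Nat.factorial]
  field_simp

lemma Gamma_add_natCast_eq_mul_prod {b : ℝ} (hb : 0 < b) (k : ℕ) :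
    Gamma (b + k) = Gamma b * ∏ i ∈ Finset.range k, (b + i) := by
  induction k with
  | zero => simp
  | succ k ih =>
    have hbk : b + k ≠ 0 := by positivity
    rw [Finset.prod_range_succ, Nat.cast_succ, ← add_assoc, Gamma_add_one hbk, ih]
    ring

lemma integrableOn_exp_mul_rpow_mul_pow {a : ℝ} (ha : -1 < a) (k : ℕ) :
    IntegrableOn (fun t : ℝ => exp (-t) * t ^ a * t ^ k) (Set.Ioi 0) := by
  have hk : (0 : ℝ) ≤ k := k.cast_nonneg
  refine (GammaIntegral_convergent (s := a + 1 + k) (by linarith)).congr_fun (fun t ht => ?_)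
    measurableSet_Ioi
  have ht : 0 < t := ht
  beta_reduce
  rw [mul_assoc, ← rpow_natCast, ← rpow_add ht]
  ring_nf

lemma integral_exp_mul_rpow_mul_pow {a : ℝ} (ha : -1 < a) (k : ℕ) :
    ∫ t in Set.Ioi (0 : ℝ), exp (-t) * t ^ a * t ^ k =
      Gamma (a + 1) * ∏ i ∈ Finset.range k, (a + 1 + i) := by
  have hk : (0 : ℝ) ≤ k := k.cast_nonneg
  rw [← Gamma_add_natCast_eq_mul_prod (by linarith), Gamma_eq_integral (by linarith)]
  refine setIntegral_congr_fun measurableSet_Ioi fun t ht => ?_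
  have ht : 0 < t := ht
  rw [mul_assoc, ← rpow_natCast, ← rpow_add ht]
  ring_nf

lemma exp_mul_rpow_mul_sum (a γ t : ℝ) {n : ℕ} (c : Fin n → ℝ) :
    exp (-t) * t ^ a * ∑ k, c k * (t / (2 * γ)) ^ (k : ℕ) =
      ∑ k, c k / (2 * γ) ^ (k : ℕ) * (exp (-t) * t ^ a * t ^ (k : ℕ)) := by
  rw [Finset.mul_sum]
  refine Finset.sum_congr rfl fun k _ => ?_
  rw [div_pow]; ring

lemma integrableOn_exp_mul_rpow_mul_sum {a : ℝ} (ha : -1 < a) (γ : ℝ) {n : ℕ} (c : Fin n → ℝ) :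
    IntegrableOn (fun t : ℝ => exp (-t) * t ^ a * ∑ k, c k * (t / (2 * γ)) ^ (k : ℕ))
      (Set.Ioi 0) := by
  simp_rw [exp_mul_rpow_mul_sum]
  exact integrable_finsetSum _ fun k _ => (integrableOn_exp_mul_rpow_mul_pow ha k).const_mul _

lemma integral_exp_mul_rpow_mul_sum {a : ℝ} (ha : -1 < a) (γ : ℝ) {n : ℕ} (c : Fin n → ℝ) :
    ∫ t in Set.Ioi (0 : ℝ), exp (-t) * t ^ a * ∑ k, c k * (t / (2 * γ)) ^ (k : ℕ) =
      ∑ k, c k / (2 * γ) ^ (k : ℕ) * (Gamma (a + 1) * ∏ i ∈ Finset.range k, (a + 1 + i)) := by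
  simp_rw [exp_mul_rpow_mul_sum]
  rw [integral_finsetSum _ fun (k : Fin n) _ =>
    (integrableOn_exp_mul_rpow_mul_pow ha (k : ℕ)).const_mul (c k / (2 * γ) ^ (k : ℕ))]
  simp_rw [integral_const_mul, integral_exp_mul_rpow_mul_pow ha]

/-- A polynomial sandwich for `(1 + u) ^ a` yields one for `besselKernelIntegral a γ` in terms of
Gamma values. -/
lemma besselKernelIntegral_mem_Icc {a γ : ℝ} (ha : -1 < a) (hγ : 0 < γ) {m n : ℕ}
    (c : Fin m → ℝ) (d : Fin n → ℝ)
    (hc : ∀ u : ℝ, 0 ≤ u → ∑ k, c k * u ^ (k : ℕ) ≤ (1 + u) ^ a)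
    (hd : ∀ u : ℝ, 0 ≤ u → (1 + u) ^ a ≤ ∑ k, d k * u ^ (k : ℕ)) :
    besselKernelIntegral a γ ∈ Set.Icc
      (∑ k, c k / (2 * γ) ^ (k : ℕ) * (Gamma (a + 1) * ∏ i ∈ Finset.range k, (a + 1 + i)))
      (∑ k, d k / (2 * γ) ^ (k : ℕ) * (Gamma (a + 1) * ∏ i ∈ Finset.range k, (a + 1 + i))) := by
  have hci := integrableOn_exp_mul_rpow_mul_sum ha γ c
  have hdi := integrableOn_exp_mul_rpow_mul_sum ha γ d
  have hle : ∀ t ∈ Set.Ioi (0 : ℝ), exp (-t) * t ^ a * (1 + t / (2 * γ)) ^ a ≤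
      exp (-t) * t ^ a * ∑ k, d k * (t / (2 * γ)) ^ (k : ℕ) := fun t ht => by
    have ht : 0 < t := ht
    exact mul_le_mul_of_nonneg_left (hd _ (by positivity)) (by positivity)
  have hi : IntegrableOn (fun t : ℝ => exp (-t) * t ^ a * (1 + t / (2 * γ)) ^ a)
      (Set.Ioi 0) := by
    refine Integrable.mono' hdi (by fun_prop) ?_
    filter_upwards [ae_restrict_mem measurableSet_Ioi] with t ht
    have ht' : 0 < t := ht
    rw [norm_of_nonneg (by positivity)]
    exact hle t ht
  rw [← integral_exp_mul_rpow_mul_sum ha, ← integral_exp_mul_rpow_mul_sum ha]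
  refine ⟨setIntegral_mono_on hci hi measurableSet_Ioi fun t ht => ?_,
    setIntegral_mono_on hi hdi measurableSet_Ioi hle⟩
  have ht : 0 < t := ht
  exact mul_le_mul_of_nonneg_left (hc _ (by positivity)) (by positivity)

lemma besselKernelIntegral_neg_half_bounds {γ : ℝ} (hγ : 0 < γ) :
    Gamma (1 / 2) * (1 - 1 / 8 * γ⁻¹ + 9 / 128 * γ⁻¹ ^ 2 - 75 / 1024 * γ⁻¹ ^ 3
      + 3675 / 32768 * γ⁻¹ ^ 4 - 59535 / 262144 * γ⁻¹ ^ 5) ≤ besselKernelIntegral (-1 / 2) γ ∧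
    besselKernelIntegral (-1 / 2) γ ≤ Gamma (1 / 2) * (1 - 1 / 8 * γ⁻¹ + 9 / 128 * γ⁻¹ ^ 2
      - 75 / 1024 * γ⁻¹ ^ 3 + 3675 / 32768 * γ⁻¹ ^ 4) := by
  have h := besselKernelIntegral_mem_Icc (a := -1 / 2) (by norm_num) hγ
    ![1, -1 / 2, 3 / 8, -5 / 16, 35 / 128, -63 / 256] ![1, -1 / 2, 3 / 8, -5 / 16, 35 / 128]
    (fun u hu => by
      simp [Fin.sum_univ_succ]
      linarith [le_one_add_rpow_neg_half hu])
    (fun u hu => by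
      simp [Fin.sum_univ_succ]
      linarith [one_add_rpow_neg_half_le hu])
  obtain ⟨h₁, h₂⟩ := h
  norm_num [Fin.sum_univ_succ, Finset.prod_range_succ, div_eq_mul_inv, mul_pow] at h₁ h₂ ⊢
  constructor <;> linarith

lemma besselKernelIntegral_half_bounds {γ : ℝ} (hγ : 0 < γ) :
    Gamma (1 / 2) * (1 + 3 / 8 * γ⁻¹ - 15 / 128 * γ⁻¹ ^ 2 + 105 / 1024 * γ⁻¹ ^ 3
      - 4725 / 32768 * γ⁻¹ ^ 4) ≤ 2 * besselKernelIntegral (1 / 2) γ ∧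
    2 * besselKernelIntegral (1 / 2) γ ≤ Gamma (1 / 2) * (1 + 3 / 8 * γ⁻¹ - 15 / 128 * γ⁻¹ ^ 2
      + 105 / 1024 * γ⁻¹ ^ 3 - 4725 / 32768 * γ⁻¹ ^ 4 + 72765 / 262144 * γ⁻¹ ^ 5) := by
  have h := besselKernelIntegral_mem_Icc (a := 1 / 2) (by norm_num) hγ
    ![1, 1 / 2, -1 / 8, 1 / 16, -5 / 128] ![1, 1 / 2, -1 / 8, 1 / 16, -5 / 128, 7 / 256]
    (fun u hu => by
      simp [Fin.sum_univ_succ]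
      linarith [le_one_add_rpow_half hu])
    (fun u hu => by
      simp [Fin.sum_univ_succ]
      linarith [one_add_rpow_half_le hu])
  rw [Gamma_add_one (by norm_num)] at h
  obtain ⟨h₁, h₂⟩ := h
  norm_num [Fin.sum_univ_succ, Finset.prod_range_succ, div_eq_mul_inv, mul_pow] at h₁ h₂ ⊢
  constructor <;> linarith

/-- For `γ > 2`, refined bounds on `K₀(γ)/K₁(γ)`. -/
theorem bessel_ratio_bounds_refined (γ : ℝ) (hγ : 2 < γ) :
    1 - 1 / (2 * γ) + 3 / (8 * γ ^ 2) - 3 / (8 * γ ^ 3) + 63 / (128 * γ ^ 4)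
        - 31 / (20 * γ ^ 5) ≤ besselK 0 γ / besselK 1 γ ∧
    besselK 0 γ / besselK 1 γ ≤
      1 - 1 / (2 * γ) + 3 / (8 * γ ^ 2) - 3 / (8 * γ ^ 3) + 63 / (128 * γ ^ 4)
        + 7 / (8 * γ ^ 5) := by
  have hγ0 : 0 < γ := by linarith
  obtain ⟨hA₁, hA₂⟩ := besselKernelIntegral_neg_half_bounds hγ0
  obtain ⟨hB₁, hB₂⟩ := besselKernelIntegral_half_bounds hγ0
  have hG : 0 < Gamma (1 / 2) := Gamma_pos_of_pos (by norm_num)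
  have hx0 : 0 < γ⁻¹ := inv_pos.2 hγ0
  have hx2 : γ⁻¹ < 1 / 2 := by rw [one_div]; exact inv_strictAnti₀ two_pos hγ
  have hexp (e c : ℝ) (n : ℕ) : e / (c * γ ^ n) = e / c * γ⁻¹ ^ n := by
    rw [inv_pow]; ring
  have hexp_one : 1 / (2 * γ) = 1 / 2 * γ⁻¹ := by ring
  rw [besselK_ratio_eq hγ0, hexp_one]
  simp only [hexp]
  generalize γ⁻¹ = x at *
  generalize besselKernelIntegral (-1 / 2) γ = A at *
  generalize 2 * besselKernelIntegral (1 / 2) γ = B at *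
  generalize Gamma (1 / 2) = G at *
  have h2 : x ^ 2 ≤ 1 / 4 := by nlinarith
  have h3 : x ^ 3 ≤ 1 / 8 := by nlinarith
  have h4 : x ^ 4 ≤ 1 / 16 := by nlinarith [sq_nonneg x]
  have h5 : x ^ 5 ≤ 1 / 32 := by nlinarith [pow_pos hx0 4]
  have p2 : 0 < x ^ 2 := by positivity
  have p3 : 0 < x ^ 3 := by positivity
  have p4 : 0 < x ^ 4 := by positivity
  have p5 : 0 < x ^ 5 := by positivity
  have hB : 0 < B := (mul_pos hG (by linarith)).trans_le hB₁
  constructor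
  · rw [le_div_iff₀ hB]
    refine (mul_le_mul_of_nonneg_left hB₂ (by linarith)).trans (le_trans ?_ hA₁)
    rw [mul_left_comm]
    refine mul_le_mul_of_nonneg_left ?_ hG.le
    have : 0 ≤ 113 / 160 + 2281287 / 2621440 * x - 818463 / 2097152 * x ^ 2
        + 1400889 / 4194304 * x ^ 3 - 12083715 / 33554432 * x ^ 4 + 451143 / 1048576 * x ^ 5 := by
      linarith
    linarith [mul_nonneg p5.le this]
  · rw [div_le_iff₀ hB]
    refine hA₂.trans (le_trans ?_ (mul_le_mul_of_nonneg_left hB₁ (by linarith)))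
    rw [mul_left_comm]
    refine mul_le_mul_of_nonneg_left ?_ hG.le
    have : 0 ≤ 79565 / 65536 + 46641 / 262144 * x + 525 / 262144 * x ^ 2
        + 78645 / 4194304 * x ^ 3 - 33075 / 262144 * x ^ 4 := by
      linarith
    linarith [mul_nonneg p5.le this]
end

section
/- Let c > 0, E > 3, and let u, s be real numbers with |u| < c and 0 < s ≤ 1/c. Then c²·E·(u·s − 1)² − (u − s·c²)² > 2·c²·(u·s − 1)², and in particular c²·E·(u·s − 1)² − (u − s·c²)² > 0. (Here E plays the role of the derivative e_p > 3 of the Synge energy, and the left-hand side is the denominator g of the self-similar ODE system for the radially symmetric relativistic Euler equations.) -/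
/-- For `c > 0`, `E > 3`, `|u| < c` and `0 < s ≤ 1/c`, the denominator
`g = c²E(us−1)² − (u−sc²)²` of the self-similar ODE system satisfies
`g > 2c²(us−1)²` and in particular `g > 0`. -/
theorem denominator_pos (c E u s : ℝ) (hc : 0 < c) (hE : 3 < E) (hu : |u| < c)
    (hs1 : 0 < s) (hs2 : s ≤ 1 / c) :
    c ^ 2 * E * (u * s - 1) ^ 2 - (u - s * c ^ 2) ^ 2 > 2 * c ^ 2 * (u * s - 1) ^ 2 ∧
    c ^ 2 * E * (u * s - 1) ^ 2 - (u - s * c ^ 2) ^ 2 > 0 := by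
  obtain ⟨hu₁, hu₂⟩ := abs_lt.mp hu
  have hsc : s * c ≤ 1 := (le_div_iff₀ hc).mp hs2
  have hus : u * s < 1 := by nlinarith
  have hpos : 0 < c ^ 2 * (u * s - 1) ^ 2 :=
    mul_pos (pow_pos hc 2) (sq_pos_of_neg (sub_neg.mpr hus))
  have hfactor : c ^ 2 * (u * s - 1) ^ 2 - (u - s * c ^ 2) ^ 2
      = ((c - u) * (c + u)) * ((1 - s * c) * (1 + s * c)) := by ring
  have hnonneg : 0 ≤ ((c - u) * (c + u)) * ((1 - s * c) * (1 + s * c)) :=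
    mul_nonneg (mul_nonneg (by linarith) (by linarith))
      (mul_nonneg (by linarith) (by positivity))
  have hE' : 0 < (E - 3) * (c ^ 2 * (u * s - 1) ^ 2) := mul_pos (by linarith) hpos
  constructor <;> linarith
end

section
/- For every real a > 0, the function γ ↦ √( (γ²·(h₁(γ)² − 1) + 3γ·h₁(γ) − 4) · (γ²·(h₁(γ)² − 1) + 3γ·h₁(γ) − 3) / (γ²·(γ·h₁(γ) + 4)) ) is integrable on the interval (a, ∞). (The expression under the square root is nonnegative since both factors in the numerator are negative; this integral equals the quantity 𝓘_p = ∫₀^{p₀} √(e_p)/(c(e+p)) dp after the change of variables p ↦ γ for the monatomic Synge gas, and its finiteness is the key estimate in the vacuum-formation case.) -/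
open MeasureTheory Real

/-- The moments `∫_γ^∞ (λ - γ)^k e^{-λ} √(λ² - γ²) dλ`. -/
noncomputable def besselMoment (γ : ℝ) (k : ℕ) : ℝ :=
  ∫ l in Set.Ioi γ, (l - γ) ^ k * (Real.exp (-l) * Real.sqrt (l ^ 2 - γ ^ 2))

theorem integrableOn_besselMoment {γ : ℝ} (hγ : 0 < γ) (k : ℕ) :
    IntegrableOn (fun l => (l - γ) ^ k * (Real.exp (-l) * Real.sqrt (l ^ 2 - γ ^ 2)))
      (Set.Ioi γ) := by
  have hGamma : IntegrableOn (fun l : ℝ => Real.exp (-l) * l ^ (k + 1)) (Set.Ioi γ) := by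
    have h := (Real.GammaIntegral_convergent (s := (k : ℝ) + 2) (by positivity)).mono_set
      (Set.Ioi_subset_Ioi hγ.le)
    refine h.congr_fun (fun l _ => ?_) measurableSet_Ioi
    have : (k : ℝ) + 2 - 1 = ((k + 1 : ℕ) : ℝ) := by push_cast; ring
    simp only [this, Real.rpow_natCast]
  refine Integrable.mono' hGamma (by fun_prop) ?_
  refine (ae_restrict_mem measurableSet_Ioi).mono fun l hl => ?_
  have hl' : γ < l := hl
  have h1 : 0 ≤ l - γ := by linarith
  have hs : Real.sqrt (l ^ 2 - γ ^ 2) ≤ l := Real.sqrt_le_iff.2 ⟨by linarith, by nlinarith⟩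
  have hp : (l - γ) ^ k ≤ l ^ k := pow_le_pow_left₀ h1 (by linarith) k
  rw [Real.norm_of_nonneg (by positivity)]
  calc (l - γ) ^ k * (Real.exp (-l) * Real.sqrt (l ^ 2 - γ ^ 2))
      ≤ l ^ k * (Real.exp (-l) * l) := by
        have h0 : 0 ≤ l := by linarith
        gcongr
    _ = Real.exp (-l) * l ^ (k + 1) := by ring

theorem besselMoment_nonneg (γ : ℝ) (k : ℕ) : 0 ≤ besselMoment γ k := by
  refine setIntegral_nonneg measurableSet_Ioi fun l hl => ?_
  have h1 : 0 ≤ l - γ := sub_nonneg.2 (le_of_lt hl)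
  positivity

theorem besselMoment_zero_pos {γ : ℝ} (hγ : 0 < γ) : 0 < besselMoment γ 0 := by
  unfold besselMoment
  rw [setIntegral_pos_iff_support_of_nonneg_ae
    (Filter.Eventually.of_forall fun l => by simp only [Pi.zero_apply]; positivity)
    (integrableOn_besselMoment hγ 0)]
  have hsub : Set.Ioi γ ⊆ (Function.support fun l : ℝ =>
      (l - γ) ^ 0 * (Real.exp (-l) * Real.sqrt (l ^ 2 - γ ^ 2))) ∩ Set.Ioi γ := by
    intro l hl
    have hl' : γ < l := hl
    have : 0 < l ^ 2 - γ ^ 2 := by nlinarith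
    refine ⟨?_, hl⟩
    simp only [Function.mem_support]
    positivity
  exact lt_of_lt_of_le (by simp) (measure_mono hsub)

/-- A nonnegative quadratic weight gives a linear inequality between consecutive moments. -/
theorem besselMoment_sq_le {γ : ℝ} (hγ : 0 < γ) (s : ℝ) (k : ℕ) :
    2 * s * besselMoment γ (k + 1) ≤ besselMoment γ (k + 2) + s ^ 2 * besselMoment γ k := by
  unfold besselMoment
  rw [← integral_const_mul, ← integral_const_mul, ← integral_add
    (integrableOn_besselMoment hγ _) ((integrableOn_besselMoment hγ _).const_mul _)]
  refine setIntegral_mono_on ((integrableOn_besselMoment hγ _).const_mul _)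
    ((integrableOn_besselMoment hγ _).add ((integrableOn_besselMoment hγ _).const_mul _))
    measurableSet_Ioi fun l hl => ?_
  have h1 : 0 ≤ l - γ := sub_nonneg.2 (le_of_lt hl)
  have h2 : 0 ≤ (l - γ) ^ k * (Real.exp (-l) * Real.sqrt (l ^ 2 - γ ^ 2)) *
      (l - γ - s) ^ 2 := by positivity
  simp only [pow_succ] at h2 ⊢
  linarith

/-- Integration by parts for the moments. -/
theorem besselMoment_recurrence {γ : ℝ} (hγ : 0 < γ) (k : ℕ) :
    besselMoment γ (k + 2) + 2 * γ * besselMoment γ (k + 1) =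
      (3 + k) * besselMoment γ (k + 1) + (3 + 2 * k) * γ * besselMoment γ k := by
  set W : ℕ → ℝ → ℝ := fun k l =>
    (l - γ) ^ k * (Real.exp (-l) * Real.sqrt (l ^ 2 - γ ^ 2)) with hW
  have hi : ∀ k, IntegrableOn (W k) (Set.Ioi γ) := integrableOn_besselMoment hγ
  let F : ℝ → ℝ := fun l =>
    Real.exp (-l) * ((l - γ) ^ k * ((l ^ 2 - γ ^ 2) * Real.sqrt (l ^ 2 - γ ^ 2)))
  let G : ℝ → ℝ := fun l => (3 + k) * W (k + 1) l + (3 + 2 * k) * γ * W k l -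
    (W (k + 2) l + 2 * γ * W (k + 1) l)
  have hi1 : IntegrableOn (fun l => (3 + k) * W (k + 1) l + (3 + 2 * k) * γ * W k l)
      (Set.Ioi γ) := ((hi _).const_mul _).add ((hi _).const_mul _)
  have hi2 : IntegrableOn (fun l => W (k + 2) l + 2 * γ * W (k + 1) l) (Set.Ioi γ) :=
    (hi _).add ((hi _).const_mul _)
  have hderiv : ∀ l ∈ Set.Ioi γ, HasDerivAt F (G l) l := by
    intro l hl
    have hl' : γ < l := hl
    have hq : 0 < l ^ 2 - γ ^ 2 := by nlinarith
    have hdq : HasDerivAt (fun l : ℝ => l ^ 2 - γ ^ 2) (2 * l) l := by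
      simpa using (hasDerivAt_pow 2 l).sub_const (γ ^ 2)
    have hde : HasDerivAt (fun l : ℝ => Real.exp (-l)) (-Real.exp (-l)) l := by
      simpa using (hasDerivAt_neg l).exp
    have hdp : HasDerivAt (fun l : ℝ => (l - γ) ^ k) (k * (l - γ) ^ (k - 1)) l := by
      simpa using ((hasDerivAt_id l).sub_const γ).fun_pow k
    refine (hde.fun_mul (hdp.fun_mul (hdq.fun_mul (hdq.sqrt hq.ne')))).congr_deriv ?_
    have hk : (k : ℝ) * (l - γ) ^ (k - 1) * (l - γ) = k * (l - γ) ^ k := by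
      rcases k with _ | k
      · simp
      · simp only [Nat.add_sub_cancel]; ring
    have hs : Real.sqrt (l ^ 2 - γ ^ 2) ≠ 0 := (Real.sqrt_pos.2 hq).ne'
    have hss : (l ^ 2 - γ ^ 2) * (2 * l / (2 * Real.sqrt (l ^ 2 - γ ^ 2))) =
        l * Real.sqrt (l ^ 2 - γ ^ 2) := by
      field_simp
      rw [Real.sq_sqrt hq.le]
    rw [hss]
    simp only [G, hW]
    linear_combination (Real.exp (-l) * Real.sqrt (l ^ 2 - γ ^ 2) * (l + γ)) * hk
  have htop : Filter.Tendsto F Filter.atTop (nhds 0) := by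
    refine squeeze_zero_norm' ?_ (Real.tendsto_pow_mul_exp_neg_atTop_nhds_zero (k + 3))
    filter_upwards [Filter.eventually_gt_atTop γ] with l hl
    have h1 : 0 ≤ l - γ := by linarith
    have h0 : 0 ≤ l := by linarith
    have hq : 0 ≤ l ^ 2 - γ ^ 2 := by nlinarith
    have hs : Real.sqrt (l ^ 2 - γ ^ 2) ≤ l := Real.sqrt_le_iff.2 ⟨h0, by nlinarith⟩
    have hp : (l - γ) ^ k ≤ l ^ k := pow_le_pow_left₀ h1 (by linarith) k
    have hq' : l ^ 2 - γ ^ 2 ≤ l ^ 2 := by nlinarith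
    rw [Real.norm_of_nonneg (by positivity)]
    calc F l ≤ Real.exp (-l) * (l ^ k * (l ^ 2 * l)) := by
          simp only [F]; gcongr
      _ = l ^ (k + 3) * Real.exp (-l) := by ring
  have hcont : ContinuousWithinAt F (Set.Ici γ) γ := by
    apply Continuous.continuousWithinAt
    fun_prop
  have hG : ∫ l in Set.Ioi γ, G l = 0 := by
    rw [integral_Ioi_of_hasDerivAt_of_tendsto hcont hderiv (hi1.sub hi2) htop]
    simp [F]
  simp only [G] at hG
  rw [integral_sub hi1 hi2, integral_add ((hi _).const_mul _) ((hi _).const_mul _),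
    integral_add (hi _) ((hi _).const_mul _), integral_const_mul, integral_const_mul,
    integral_const_mul] at hG
  simp only [besselMoment]
  simp only [hW] at hG
  linarith

theorem besselK_one_eq_s18 (γ : ℝ) : besselK 1 γ = besselMoment γ 0 / γ := by
  have h : ((1 : ℕ) : ℝ) - 1 / 2 = 1 / 2 := by norm_num
  simp only [besselK, besselMoment, h, ← Real.sqrt_eq_rpow, pow_zero, one_mul]
  norm_num
  ring

theorem besselK_two_eq {γ : ℝ} (hγ : 0 < γ) :
    besselK 2 γ = (γ * besselMoment γ 0 + besselMoment γ 1) / γ ^ 2 := by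
  have hint : ∫ l in Set.Ioi γ, Real.exp (-l) * (l ^ 2 - γ ^ 2) ^ (((2 : ℕ) : ℝ) - 1 / 2) =
      besselMoment γ 2 + 2 * γ * besselMoment γ 1 := by
    unfold besselMoment
    rw [← integral_const_mul, ← integral_add
      (integrableOn_besselMoment hγ _) ((integrableOn_besselMoment hγ _).const_mul _)]
    refine setIntegral_congr_fun measurableSet_Ioi fun l hl => ?_
    have hl' : γ < l := hl
    have hq : 0 < l ^ 2 - γ ^ 2 := by nlinarith
    have h : ((2 : ℕ) : ℝ) - 1 / 2 = 1 + 1 / 2 := by norm_num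
    simp only [h]
    rw [Real.rpow_add hq, Real.rpow_one, ← Real.sqrt_eq_rpow]
    ring
  have hrec := besselMoment_recurrence hγ 0
  norm_num at hrec
  rw [besselK, hint, hrec]
  norm_num [Nat.factorial]
  ring

theorem hRatio_one_eq {γ : ℝ} (hγ : 0 < γ) :
    hRatio 1 γ = γ / (γ + besselMoment γ 1 / besselMoment γ 0) := by
  have h0 := besselMoment_zero_pos hγ
  have h1 := besselMoment_nonneg γ 1
  rw [hRatio, besselK_one_eq_s18, besselK_two_eq hγ]
  field_simp

/-- Second order asymptotics of `γ h₁(γ)`, with explicit constants. -/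
theorem abs_mul_hRatio_one_sub_le {γ : ℝ} (hγ : 0 < γ) :
    |γ * hRatio 1 γ - γ + 3 / 2| ≤ 15 / γ ∧ γ - 3 ≤ γ * hRatio 1 γ := by
  have h0 := besselMoment_zero_pos hγ
  have r0 := besselMoment_recurrence hγ 0
  have r1 := besselMoment_recurrence hγ 1
  have q0 := besselMoment_sq_le hγ 3 0
  have q1 := besselMoment_sq_le hγ 4 1
  have hm0 : 0 ≤ besselMoment γ 1 / besselMoment γ 0 :=
    div_nonneg (besselMoment_nonneg γ 1) h0.le
  have hn0 : 0 ≤ besselMoment γ 2 / besselMoment γ 0 :=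
    div_nonneg (besselMoment_nonneg γ 2) h0.le
  rw [hRatio_one_eq hγ]
  norm_num at r0 r1 q0 q1
  set m := besselMoment γ 1 / besselMoment γ 0 with hm
  set n := besselMoment γ 2 / besselMoment γ 0 with hn
  have e1 : besselMoment γ 1 = m * besselMoment γ 0 := by rw [hm]; field_simp
  have e2 : besselMoment γ 2 = n * besselMoment γ 0 := by rw [hn]; field_simp
  have hr0 : n + 2 * γ * m = 3 * m + 3 * γ := by
    apply mul_right_cancel₀ h0.ne'
    rw [e1, e2] at r0
    linarith
  have hm3 : m ≤ 3 := by
    have : 6 * m ≤ n + 9 := by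
      apply le_of_mul_le_mul_right _ h0
      rw [e1, e2] at q0
      linarith
    by_contra! hlt
    nlinarith
  have hn12 : n ≤ 12 := by
    have : (2 * γ + 4) * n ≤ (5 * γ + 16) * m := by
      apply le_of_mul_le_mul_right _ h0
      rw [e1, e2] at r1 q1
      linarith
    by_contra! hlt
    nlinarith
  have hγm : 0 < γ + m := by linarith
  have hid : γ * (γ / (γ + m)) = γ - m + m ^ 2 / (γ + m) := by
    field_simp
    ring
  have hmsq : 0 ≤ m ^ 2 / (γ + m) := by positivity
  refine ⟨?_, by rw [hid]; linarith⟩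
  have hdiff : γ * (γ / (γ + m)) - γ + 3 / 2 = (n - 3 * m) / (2 * γ) + m ^ 2 / (γ + m) := by
    rw [hid, show n = 3 * m + 3 * γ - 2 * γ * m by linarith]
    field_simp
    ring
  have hb1 : |(n - 3 * m) / (2 * γ)| ≤ 6 / γ := by
    rw [abs_div, abs_of_pos (by positivity : 0 < 2 * γ), div_le_div_iff₀ (by positivity) hγ]
    have : |n - 3 * m| ≤ 12 := abs_le.2 ⟨by linarith, by linarith⟩
    nlinarith
  have hb2 : |m ^ 2 / (γ + m)| ≤ 9 / γ := by
    rw [abs_of_nonneg hmsq]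
    exact div_le_div₀ (by norm_num) (by nlinarith) hγ (by linarith)
  rw [hdiff]
  calc _ ≤ _ := abs_add_le _ _
    _ ≤ 6 / γ + 9 / γ := add_le_add hb1 hb2
    _ = 15 / γ := by ring

theorem measurable_besselK (j : ℕ) : Measurable (besselK j) := by
  have hset : MeasurableSet {p : ℝ × ℝ | p.1 < p.2} :=
    measurableSet_lt measurable_fst measurable_snd
  have hf : Measurable (fun p : ℝ × ℝ =>
      Real.exp (-p.2) * (p.2 ^ 2 - p.1 ^ 2) ^ ((j : ℝ) - 1 / 2)) := by fun_prop
  have h := ((hf.indicator hset).stronglyMeasurable.integral_prod_right'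
    (ν := (volume : Measure ℝ))).measurable
  have heq : (fun γ : ℝ => ∫ l in Set.Ioi γ,
      Real.exp (-l) * (l ^ 2 - γ ^ 2) ^ ((j : ℝ) - 1 / 2)) = fun γ => ∫ l,
      {p : ℝ × ℝ | p.1 < p.2}.indicator (fun p : ℝ × ℝ =>
        Real.exp (-p.2) * (p.2 ^ 2 - p.1 ^ 2) ^ ((j : ℝ) - 1 / 2)) (γ, l) := by
    funext γ
    rw [← integral_indicator measurableSet_Ioi]
    rfl
  unfold besselK
  refine Measurable.mul (by fun_prop) ?_
  rw [heq]
  exact h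

theorem measurable_hRatio (i : ℕ) : Measurable (hRatio i) :=
  (measurable_besselK i).div (measurable_besselK (i + 1))

/-- For every `a > 0`, the integrand of `𝓘_p` (after the change of variables `p ↦ γ` for the
monatomic Synge gas) is integrable on `(a, ∞)`. -/
theorem integrand_integrableOn (a : ℝ) (ha : 0 < a) :
    MeasureTheory.IntegrableOn (fun γ : ℝ =>
      Real.sqrt ((γ ^ 2 * (hRatio 1 γ ^ 2 - 1) + 3 * γ * hRatio 1 γ - 4) *
        (γ ^ 2 * (hRatio 1 γ ^ 2 - 1) + 3 * γ * hRatio 1 γ - 3) /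
        (γ ^ 2 * (γ * hRatio 1 γ + 4)))) (Set.Ioi a) := by
  have hmeas := measurable_hRatio 1
  have hint : IntegrableOn (fun γ : ℝ => (40 + (15 / a) ^ 2) * γ ^ (-(3 / 2) : ℝ)) (Set.Ioi a) :=
    (integrableOn_Ioi_rpow_of_lt (by norm_num) ha).const_mul _
  refine Integrable.mono' hint (Measurable.aestronglyMeasurable (by fun_prop)) ?_
  refine (ae_restrict_mem measurableSet_Ioi).mono fun γ hγa => ?_
  have hγa' : a < γ := hγa
  have hγ : 0 < γ := ha.trans hγa'
  obtain ⟨hδ, hlow⟩ := abs_mul_hRatio_one_sub_le hγ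
  set δ := γ * hRatio 1 γ - γ + 3 / 2 with hδdef
  have hX : γ ^ 2 * (hRatio 1 γ ^ 2 - 1) + 3 * γ * hRatio 1 γ =
      2 * (γ * δ) + δ ^ 2 - 9 / 4 := by
    rw [hδdef]; ring
  have hγδ : |γ * δ| ≤ 15 := by
    rw [abs_mul, abs_of_pos hγ]
    calc γ * |δ| ≤ γ * (15 / γ) := by gcongr
      _ = 15 := by field_simp
  have hδsq : δ ^ 2 ≤ (15 / a) ^ 2 := by
    rw [← sq_abs]
    have : |δ| ≤ 15 / a := hδ.trans (by gcongr)
    gcongr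
  rw [hX, Real.norm_of_nonneg (Real.sqrt_nonneg _)]
  have hC : 0 ≤ 40 + (15 / a) ^ 2 := by positivity
  have hnum : (2 * (γ * δ) + δ ^ 2 - 9 / 4 - 4) * (2 * (γ * δ) + δ ^ 2 - 9 / 4 - 3) ≤
      (40 + (15 / a) ^ 2) ^ 2 := by
    obtain ⟨h1, h2⟩ := abs_le.1 hγδ
    have h3 := sq_nonneg δ
    have hA : |2 * (γ * δ) + δ ^ 2 - 9 / 4 - 4| ≤ 40 + (15 / a) ^ 2 :=
      abs_le.2 ⟨by nlinarith, by nlinarith⟩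
    have hB : |2 * (γ * δ) + δ ^ 2 - 9 / 4 - 3| ≤ 40 + (15 / a) ^ 2 :=
      abs_le.2 ⟨by nlinarith, by nlinarith⟩
    calc _ ≤ |_| := le_abs_self _
      _ = _ := abs_mul _ _
      _ ≤ (40 + (15 / a) ^ 2) * (40 + (15 / a) ^ 2) :=
        mul_le_mul hA hB (abs_nonneg _) hC
      _ = _ := by ring
  have hden : γ ^ 3 ≤ γ ^ 2 * (γ * hRatio 1 γ + 4) := by
    have : γ ^ 2 * γ ≤ γ ^ 2 * (γ * hRatio 1 γ + 4) := by
      gcongr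
      linarith
    linarith [this, pow_succ γ 2]
  have hpow : (γ ^ (-(3 / 2) : ℝ)) ^ 2 = (γ ^ 3)⁻¹ := by
    rw [← Real.rpow_natCast, ← Real.rpow_mul hγ.le, ← Real.rpow_natCast γ 3,
      ← Real.rpow_neg hγ.le]
    norm_num
  refine Real.sqrt_le_iff.2 ⟨by positivity, ?_⟩
  rw [mul_pow, hpow, ← div_eq_mul_inv]
  exact div_le_div₀ (by positivity) hnum (by positivity) hden
end

section
/- For every real γ with γ₀ < γ ≤ √2, where γ₀ = 2·exp(−C_E) and C_E is the Euler–Mascheroni constant, one has f(γ) := −1/2 + (3/8)·γ² + (1/16)·γ⁴ + (41/13824)·γ⁶ + (1 + (1/2)·γ² + (3/64)·γ⁴ + (19/13824)·γ⁶)·ln(γ₀/γ) ≥ 0. -/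
theorem eulerMascheroniConstant_lt_half_log_two_add :
    Real.eulerMascheroniConstant < Real.log 2 / 2 + 0.2347 := by
  have h := Real.eulerMascheroniConstant_lt_eulerMascheroniSeq' 128
  have harmonic_lt : ((harmonic 128 : ℚ) : ℝ) < 5.4333 := by norm_num
  have log_eq : Real.log ((128 : ℕ) : ℝ) = 7 * Real.log 2 := by
    rw [show ((128 : ℕ) : ℝ) = 2 ^ 7 by norm_num, Real.log_pow]
    norm_num
  rw [Real.eulerMascheroniSeq', if_neg (by norm_num), log_eq] at h
  linarith [Real.log_two_gt_d9]

/-- The polynomial lower bound obtained by setting `γ = √2 (1 - u)`. -/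
theorem polynomial_bound_nonneg {u : ℝ} (hu : 0 ≤ u) (hu' : u ≤ 0.2347) :
    0 ≤ -1 / 2 + 3 / 8 * (2 * (1 - u) ^ 2) + 1 / 16 * (2 * (1 - u) ^ 2) ^ 2 +
      41 / 13824 * (2 * (1 - u) ^ 2) ^ 3 +
      (1 + 1 / 2 * (2 * (1 - u) ^ 2) + 3 / 64 * (2 * (1 - u) ^ 2) ^ 2 +
        19 / 13824 * (2 * (1 - u) ^ 2) ^ 3) * (u - 0.2347) := by
  have linear : 0 ≤ u * (0.2347 - u) := mul_nonneg hu (by linarith)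
  have cubic : 0 ≤ u ^ 3 * (0.2347 - u) := mul_nonneg (by positivity) (by linarith)
  have quintic : 0 ≤ u ^ 5 * (0.2347 - u) := mul_nonneg (by positivity) (by linarith)
  have cube_nonneg : 0 ≤ u ^ 3 := by positivity
  have fifth_nonneg : 0 ≤ u ^ 5 := by positivity
  have seventh_nonneg : 0 ≤ u ^ 7 := by positivity
  linarith

/-- For `γ₀ < γ ≤ √2` (with `γ₀ = 2 e^{-C_E}`), the auxiliary function
`f(γ) = −1/2 + (3/8)γ² + (1/16)γ⁴ + (41/13824)γ⁶
        + (1 + (1/2)γ² + (3/64)γ⁴ + (19/13824)γ⁶)·ln(γ₀/γ)` is nonnegative. -/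
theorem aux_f_nonneg (γ : ℝ)
    (h1 : 2 * Real.exp (-Real.eulerMascheroniConstant) < γ) (h2 : γ ≤ Real.sqrt 2) :
    -1 / 2 + 3 / 8 * γ ^ 2 + 1 / 16 * γ ^ 4 + 41 / 13824 * γ ^ 6 +
      (1 + 1 / 2 * γ ^ 2 + 3 / 64 * γ ^ 4 + 19 / 13824 * γ ^ 6) *
        Real.log (2 * Real.exp (-Real.eulerMascheroniConstant) / γ) ≥ 0 := by
  have hγ₀ : 0 < 2 * Real.exp (-Real.eulerMascheroniConstant) := by positivity
  have hγ : 0 < γ := hγ₀.trans h1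
  have hsqrt : 0 < Real.sqrt 2 := by positivity
  obtain ⟨u, rfl⟩ : ∃ u, γ = Real.sqrt 2 * (1 - u) :=
    ⟨1 - γ / Real.sqrt 2, by field_simp; ring⟩
  have hu_lt : 0 < 1 - u := pos_of_mul_pos_right hγ hsqrt.le
  have hu : 0 ≤ u := by
    by_contra! h
    nlinarith
  have hlog : Real.log (2 * Real.exp (-Real.eulerMascheroniConstant) / (Real.sqrt 2 * (1 - u))) =
      Real.log 2 / 2 - Real.eulerMascheroniConstant - Real.log (1 - u) := by
    rw [Real.log_div hγ₀.ne' hγ.ne', Real.log_mul two_ne_zero (Real.exp_ne_zero _), Real.log_exp,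
      Real.log_mul hsqrt.ne' hu_lt.ne', Real.log_sqrt zero_le_two]
    ring
  have hlog_neg :
      Real.log (2 * Real.exp (-Real.eulerMascheroniConstant) / (Real.sqrt 2 * (1 - u))) < 0 :=
    Real.log_neg (div_pos hγ₀ hγ) ((div_lt_one hγ).2 h1)
  have hlog_le : Real.log (1 - u) ≤ -u := by
    linarith [Real.log_le_sub_one_of_pos hu_lt]
  have hC := eulerMascheroniConstant_lt_half_log_two_add
  have hu' : u ≤ 0.2347 := by linarith
  have hlog_ge : u - 0.2347 ≤
      Real.log (2 * Real.exp (-Real.eulerMascheroniConstant) / (Real.sqrt 2 * (1 - u))) := by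
    linarith
  have hsq : (Real.sqrt 2 * (1 - u)) ^ 2 = 2 * (1 - u) ^ 2 := by
    rw [mul_pow, Real.sq_sqrt zero_le_two]
  rw [show (Real.sqrt 2 * (1 - u)) ^ 4 = ((Real.sqrt 2 * (1 - u)) ^ 2) ^ 2 by ring,
    show (Real.sqrt 2 * (1 - u)) ^ 6 = ((Real.sqrt 2 * (1 - u)) ^ 2) ^ 3 by ring, hsq]
  refine (polynomial_bound_nonneg hu hu').trans ?_
  gcongr
end
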